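/- There exists a bijection v : Fin 81 → (Fin 4 → Fin 3) such that for all indices i and all k with 1 ≤ k ≤ 3 and i + k < 81, hammingDist (v i) (v (i+k)) ≥ 5 − k. That is, K_3^4 is radio graceful. -/

import Mathlib

/-- The ordering, each vertex being encoded by its base-3 expansion. Apart from the last vertex,
entry `i + 40` is the coordinatewise negative of entry `i`. -/
def ordList : List ℕ :=
  [45, 4, 80, 37, 57, 25, 29, 67, 18, 34, 65, 48, 16, 54, 41, 24, 64, 30, 17, 76, 36, 7, 68, 51,
   10, 62, 21, 43, 2, 78, 13, 35, 73, 3, 71, 28, 75, 11, 61, 50, 63, 8, 40, 74, 33, 14, 55, 53,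
   9, 59, 46, 69, 23, 27, 79, 12, 47, 60, 22, 44, 72, 5, 52, 66, 20, 31, 15, 77, 1, 39, 26, 58,
   38, 6, 49, 56, 42, 19, 32, 70, 0]

/-- The `n`-th vertex of the ordering. -/
def ordVertex (n : ℕ) (c : Fin 4) : Fin 3 :=
  ⟨ordList.getD n 0 / 3 ^ c.val % 3, Nat.mod_lt _ (by norm_num)⟩

/-- Value of a vertex in base 3. -/
def vertexCode (x : Fin 4 → Fin 3) : ℕ :=
  (x 0).val + 3 * (x 1).val + 9 * (x 2).val + 27 * (x 3).val

set_option maxRecDepth 100000 in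
theorem ordVertex_code : ∀ i : Fin 81,
    ordList.idxOf (vertexCode (ordVertex i.val)) = i.val := by
  decide +kernel

set_option maxRecDepth 100000 in
theorem ordVertex_dist : ∀ k : Fin 4, 1 ≤ k.val → ∀ i : Fin 81, i.val + k.val < 81 →
    5 - k.val ≤ hammingDist (ordVertex i.val) (ordVertex (i.val + k.val)) := by
  decide +kernel

/-- K_3^4 is radio graceful: there is an ordering of its 81 vertices inducing a consecutive
radio labeling. -/
theorem stmt_14 : ∃ v : Fin 81 → Fin 4 → Fin 3, Function.Bijective v ∧
    ∀ i k : ℕ, 1 ≤ k → k ≤ 3 → (h : i + k < 81) →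
      hammingDist (v ⟨i, by omega⟩) (v ⟨i + k, h⟩) ≥ 5 - k := by
  refine ⟨fun i => ordVertex i.val, ?_, ?_⟩
  · rw [Fintype.bijective_iff_injective_and_card]
    refine ⟨fun i j hij => ?_, by simp⟩
    have hij' : ordVertex i.val = ordVertex j.val := hij
    apply Fin.ext
    rw [← ordVertex_code i, ← ordVertex_code j, hij']
  · intro i k h1 h3 h
    exact ordVertex_dist ⟨k, by omega⟩ h1 ⟨i, by omega⟩ h
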